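/- arXiv:2311.15049 — 10 statements merged into one kernel-verified Lean document; each statement's English description precedes it below -/
import Mathlib

section
/- Let P be a nonempty lattice which is order compact, that is, every ultrafilter on P order converges to some element of P. Then P is a complete lattice: every subset of P has a supremum and an infimum in P. -/
/-- A filter `F` on a lattice order converges to `p` if it contains a family of
order intervals whose intersection equals `{p}`. -/
def OrderConvergesTo {P : Type*} [Lattice P] (F : Filter P) (p : P) : Prop :=
  ∃ S : Set (P × P),
    (∀ q ∈ S, q.1 ≤ q.2) ∧
    (∀ q ∈ S, Set.Icc q.1 q.2 ∈ F) ∧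
    (⋂ q ∈ S, Set.Icc q.1 q.2) = {p}

namespace OrderConvergesTo

variable {P : Type*} [Lattice P] {F : Filter P} [F.NeBot] {p c : P}

/-- An eventual lower bound of a filter is below every order limit. -/
theorem le_of_eventually_le (h : OrderConvergesTo F p) (hc : ∀ᶠ x in F, c ≤ x) : c ≤ p := by
  obtain ⟨S, -, hF, hS⟩ := h
  have hp : p ∈ ⋂ q ∈ S, Set.Icc q.1 q.2 := hS ▸ Set.mem_singleton p
  rw [Set.mem_iInter₂] at hp
  have hsup : p ⊔ c ∈ ⋂ q ∈ S, Set.Icc q.1 q.2 := by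
    refine Set.mem_iInter₂.2 fun q hq => ⟨(hp q hq).1.trans le_sup_left, ?_⟩
    obtain ⟨x, hcx, hx⟩ := (hc.and (hF q hq)).exists
    exact sup_le (hp q hq).2 (hcx.trans hx.2)
  rw [hS] at hsup
  exact sup_eq_left.1 hsup

/-- An eventual upper bound of a filter is above every order limit. -/
theorem le_of_eventually_ge (h : OrderConvergesTo F p) (hc : ∀ᶠ x in F, x ≤ c) : p ≤ c := by
  obtain ⟨S, -, hF, hS⟩ := h
  have hp : p ∈ ⋂ q ∈ S, Set.Icc q.1 q.2 := hS ▸ Set.mem_singleton p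
  rw [Set.mem_iInter₂] at hp
  have hinf : p ⊓ c ∈ ⋂ q ∈ S, Set.Icc q.1 q.2 := by
    refine Set.mem_iInter₂.2 fun q hq => ⟨?_, inf_le_left.trans (hp q hq).2⟩
    obtain ⟨x, hxc, hx⟩ := (hc.and (hF q hq)).exists
    exact le_inf (hp q hq).1 (hx.1.trans hxc)
  rw [hS] at hinf
  exact inf_eq_left.1 hinf

end OrderConvergesTo

/-- A nonempty order compact lattice is a complete lattice. -/
theorem orderCompact_complete {P : Type*} [Lattice P] [Nonempty P]
    (hcompact : ∀ U : Ultrafilter P, ∃ p : P, OrderConvergesTo (U : Filter P) p) :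
    ∀ S : Set P, (∃ a : P, IsLUB S a) ∧ (∃ b : P, IsGLB S b) := by
  obtain ⟨m, hm⟩ := hcompact (Ultrafilter.of Filter.atBot)
  let _ : OrderBot P :=
    { bot := m
      bot_le := fun x =>
        hm.le_of_eventually_ge (Ultrafilter.of_le _ (Filter.eventually_le_atBot x)) }
  have hlub : ∀ S : Set P, ∃ a, IsLUB S a := by
    intro S
    let sups : Finset S → P := fun s => s.sup Subtype.val
    obtain ⟨a, ha⟩ := hcompact (Ultrafilter.of (Filter.atTop.map sups))
    refine ⟨a, fun d hd => ha.le_of_eventually_le (Ultrafilter.of_le _ ?_),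
      fun u hu => ha.le_of_eventually_ge (Ultrafilter.of_le _ ?_)⟩
    · refine Filter.mem_map.2 ?_
      filter_upwards [Filter.eventually_ge_atTop {(⟨d, hd⟩ : S)}] with s hs
      exact Finset.le_sup (f := Subtype.val) (Finset.singleton_subset_iff.1 hs)
    · exact Filter.mem_map.2 (Filter.Eventually.of_forall fun s =>
        Finset.sup_le fun x _ => hu x.2)
  intro S
  obtain ⟨b, hb⟩ := hlub (lowerBounds S)
  exact ⟨hlub S, b, isLUB_lowerBounds.1 hb⟩
end

section
/- Let Ω be a set, f, g : Ω → ℝ with f ≤ g pointwise, and let P = [f,g] = {h : Ω → ℝ, f ≤ h ≤ g pointwise}. Let F be a filter on Ω → ℝ with P ∈ F and let h ∈ P. Then F order converges to h (i.e., F contains a family of order intervals of Ω → ℝ, with respect to the pointwise order, whose intersection is {h}) if and only if F converges to h pointwise, i.e., for every ω ∈ Ω the image of F under evaluation at ω converges to h(ω) in ℝ. -/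
theorem OrderConvergesTo.tendsto_apply {Ω : Type*} {F : Filter (Ω → ℝ)} {h : Ω → ℝ}
    (hFh : OrderConvergesTo F h) (ω : Ω) :
    Filter.Tendsto (fun w : Ω → ℝ => w ω) F (nhds (h ω)) := by
  classical
  obtain ⟨S, -, hSF, hS⟩ := hFh
  have hmem : ∀ q ∈ S, h ∈ Set.Icc q.1 q.2 := by
    have : h ∈ ⋂ q ∈ S, Set.Icc q.1 q.2 := hS ▸ Set.mem_singleton h
    simpa only [Set.mem_iInter] using this
  have key : ∀ a, a ≠ h ω → ∃ q ∈ S, Function.update h ω a ∉ Set.Icc q.1 q.2 := by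
    intro a ha
    by_contra! hcon
    have : Function.update h ω a ∈ ⋂ q ∈ S, Set.Icc q.1 q.2 := Set.mem_iInter₂.2 hcon
    rw [hS, Set.mem_singleton_iff, Function.update_eq_self_iff] at this
    exact ha this
  refine tendsto_order.2 ⟨fun a ha => ?_, fun a ha => ?_⟩
  · obtain ⟨q, hq, hqa⟩ := key a ha.ne
    have hlt : a < q.1 ω := by
      by_contra! hle
      exact hqa ⟨le_update_iff.2 ⟨hle, fun x _ => (hmem q hq).1 x⟩,
        update_le_iff.2 ⟨ha.le.trans ((hmem q hq).2 ω), fun x _ => (hmem q hq).2 x⟩⟩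
    filter_upwards [hSF q hq] with w hw using hlt.trans_le (hw.1 ω)
  · obtain ⟨q, hq, hqa⟩ := key a ha.ne'
    have hlt : q.2 ω < a := by
      by_contra! hle
      exact hqa ⟨le_update_iff.2 ⟨((hmem q hq).1 ω).trans ha.le,
        fun x _ => (hmem q hq).1 x⟩, update_le_iff.2 ⟨hle, fun x _ => (hmem q hq).2 x⟩⟩
    filter_upwards [hSF q hq] with w hw using (hw.2 ω).trans_lt hlt

theorem orderConvergesTo_of_tendsto_apply {Ω : Type*} {f g h : Ω → ℝ} {F : Filter (Ω → ℝ)}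
    (hF : Set.Icc f g ∈ F) (hh : h ∈ Set.Icc f g)
    (hlim : ∀ ω : Ω, Filter.Tendsto (fun w : Ω → ℝ => w ω) F (nhds (h ω))) :
    OrderConvergesTo F h := by
  classical
  refine ⟨{q | h ∈ Set.Icc q.1 q.2 ∧ Set.Icc q.1 q.2 ∈ F},
    fun q hq => hq.1.1.trans hq.1.2, fun q hq => hq.2, ?_⟩
  refine Set.Subset.antisymm (fun w hw => ?_)
    (Set.singleton_subset_iff.2 (Set.mem_iInter₂.2 fun q hq => hq.1))
  rw [Set.mem_iInter₂] at hw
  have key : ∀ ω, ∀ ε > 0, w ω ∈ Set.Icc (h ω - ε) (h ω + ε) := by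
    intro ω ε hε
    have hbox : ∀ v ∈ Set.Icc f g, v ω ∈ Set.Icc (h ω - ε) (h ω + ε) →
        v ∈ Set.Icc (Function.update f ω (h ω - ε)) (Function.update g ω (h ω + ε)) :=
      fun v hv hvω => ⟨update_le_iff.2 ⟨hvω.1, fun x _ => hv.1 x⟩,
        le_update_iff.2 ⟨hvω.2, fun x _ => hv.2 x⟩⟩
    have hwbox := hw (Function.update f ω (h ω - ε), Function.update g ω (h ω + ε))
      ⟨hbox h hh ⟨by linarith, by linarith⟩, by
        filter_upwards [hF, hlim ω (Icc_mem_nhds (sub_lt_self _ hε) (lt_add_of_pos_right _ hε))]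
          with v hv hvω using hbox v hv hvω⟩
    exact ⟨(update_le_iff.1 hwbox.1).1, (le_update_iff.1 hwbox.2).1⟩
  rw [Set.mem_singleton_iff]
  funext ω
  exact le_antisymm (le_of_forall_pos_le_add fun ε hε => (key ω ε hε).2)
    (le_of_forall_pos_le_add fun ε hε => sub_le_iff_le_add.1 (key ω ε hε).1)


/-- On an order interval of `Ω → ℝ` (pointwise order), a filter containing
the interval order converges to a point of the interval iff it converges pointwise. -/
theorem orderConvergence_iff_pointwise {Ω : Type*} (f g : Ω → ℝ) (hfg : f ≤ g)
    (F : Filter (Ω → ℝ)) (hF : Set.Icc f g ∈ F) (h : Ω → ℝ) (hh : h ∈ Set.Icc f g) :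
    OrderConvergesTo F h ↔
      ∀ ω : Ω, Filter.Tendsto (fun w : Ω → ℝ => w ω) F (nhds (h ω)) :=
  ⟨fun hFh ω => hFh.tendsto_apply ω, orderConvergesTo_of_tendsto_apply hF hh⟩
end

section
/- Let A be an atomless Boolean algebra (A has no atoms, i.e., there is no a ∈ A with ⊥ < a such that the only elements below a are ⊥ and a). If A is the union of finitely many order intervals [a₁,b₁] ∪ ... ∪ [aₙ,bₙ] (with aᵢ ≤ bᵢ), then [aᵢ,bᵢ] = A for some i. Equivalently, A cannot be covered by a finite collection of proper order intervals. -/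
/-- In an atomless order, below every nontrivial element there is a nontrivial element that lies
above no member of a given finite set of nontrivial elements. -/
theorem exists_ne_bot_le_forall_not_le {A : Type*} [PartialOrder A] [OrderBot A]
    (hatomless : ∀ a : A, ¬ IsAtom a) (s : Finset A) (hs : ∀ e ∈ s, e ≠ ⊥) {c : A} (hc : c ≠ ⊥) :
    ∃ d, d ≠ ⊥ ∧ d ≤ c ∧ ∀ e ∈ s, ¬ e ≤ d := by
  classical
  induction s using Finset.induction_on with
  | empty => exact ⟨c, hc, le_rfl, by simp⟩
  | insert e s _ ih =>
    obtain ⟨d, hd, hdc, hds⟩ := ih fun x hx => hs x (Finset.mem_insert_of_mem hx)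
    by_cases hed : e ≤ d
    · have he : e ≠ ⊥ := hs e (Finset.mem_insert_self e s)
      obtain ⟨f, hfe, hf⟩ : ∃ f, f < e ∧ f ≠ ⊥ := by
        by_contra! h
        exact hatomless e ⟨he, h⟩
      refine ⟨f, hf, hfe.le.trans (hed.trans hdc), fun x hx hxf => ?_⟩
      rcases Finset.mem_insert.1 hx with rfl | hx
      · exact hfe.not_ge hxf
      · exact hds x hx (hxf.trans (hfe.le.trans hed))
    · refine ⟨d, hd, hdc, fun x hx => ?_⟩
      rcases Finset.mem_insert.1 hx with rfl | hx
      exacts [hed, hds x hx]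

/-- In an atomless Boolean algebra, if `x` splits every member of a finite set `s`, then `x` can be
shrunk so as to split, in addition, a nontrivial element `c ≤ x`. -/
theorem exists_splits_insert_of_le {A : Type*} [BooleanAlgebra A]
    (hatomless : ∀ a : A, ¬ IsAtom a) {s : Finset A} {x c : A} (hc : c ≠ ⊥)
    (hx : ∀ e ∈ s, ¬ e ≤ x ∧ ¬ e ≤ xᶜ) (hcx : c ≤ x) :
    ∃ y, (¬ c ≤ y ∧ ¬ c ≤ yᶜ) ∧ ∀ e ∈ s, ¬ e ≤ y ∧ ¬ e ≤ yᶜ := by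
  classical
  obtain ⟨d, hd, hdc, hds⟩ := exists_ne_bot_le_forall_not_le hatomless
    (insert c (s.image (· ⊓ x))) (by
      intro e he
      rcases Finset.mem_insert.1 he with rfl | he
      · exact hc
      · obtain ⟨t, ht, rfl⟩ := Finset.mem_image.1 he
        exact fun h => (hx t ht).2 (le_compl_iff_disjoint_right.2 (disjoint_iff.2 h))) hc
  have key : ∀ e, e ≤ (x \ d)ᶜ → e ⊓ x ≤ d := fun e he => by
    have h : Disjoint e (x \ d) := le_compl_iff_disjoint_right.1 he
    rw [← sdiff_eq_bot_iff, inf_sdiff_assoc]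
    exact h.eq_bot
  refine ⟨x \ d, ⟨fun h => ?_, fun h => ?_⟩, fun e he => ⟨fun h => ?_, fun h => ?_⟩⟩
  · exact hd (disjoint_self.1 (disjoint_sdiff_self_left.mono_left (hdc.trans h)))
  · exact hds c (Finset.mem_insert_self _ _) (inf_eq_left.2 hcx ▸ key c h)
  · exact (hx e he).1 (h.trans sdiff_le)
  · exact hds _ (Finset.mem_insert_of_mem (Finset.mem_image_of_mem _ he)) (key e h)

/-- In an atomless Boolean algebra, finitely many nontrivial elements can be split simultaneously
by a single element and its complement. -/
theorem exists_forall_not_le_and_not_le_compl {A : Type*} [BooleanAlgebra A]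
    (hatomless : ∀ a : A, ¬ IsAtom a) (s : Finset A) (hs : ∀ e ∈ s, e ≠ ⊥) :
    ∃ x, ∀ e ∈ s, ¬ e ≤ x ∧ ¬ e ≤ xᶜ := by
  classical
  induction s using Finset.induction_on with
  | empty => exact ⟨⊥, by simp⟩
  | insert c s _ ih =>
    obtain ⟨x, hx⟩ := ih fun e he => hs e (Finset.mem_insert_of_mem he)
    have hc : c ≠ ⊥ := hs c (Finset.mem_insert_self c s)
    simp only [Finset.forall_mem_insert]
    by_cases h₁ : c ≤ x
    · exact exists_splits_insert_of_le hatomless hc hx h₁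
    by_cases h₂ : c ≤ xᶜ
    · exact exists_splits_insert_of_le hatomless hc
        (fun e he => ⟨(hx e he).2, by simpa using (hx e he).1⟩) h₂
    exact ⟨x, ⟨h₁, h₂⟩, hx⟩

/-- An atomless Boolean algebra cannot be covered by finitely many proper
order intervals: if it equals a finite union of order intervals, one of them is everything. -/
theorem atomless_not_finite_union_of_proper_intervals {A : Type*} [BooleanAlgebra A]
    (hatomless : ∀ a : A, ¬ IsAtom a)
    (n : ℕ) (a b : Fin n → A) (hab : ∀ i, a i ≤ b i)
    (hcover : (⋃ i, Set.Icc (a i) (b i)) = Set.univ) :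
    ∃ i, Set.Icc (a i) (b i) = Set.univ := by
  classical
  by_contra! hproper
  obtain ⟨x, hx⟩ := exists_forall_not_le_and_not_le_compl hatomless
    ((Finset.univ.image a ∪ Finset.univ.image fun i => (b i)ᶜ).erase ⊥)
    fun e he => Finset.ne_of_mem_erase he
  obtain ⟨i, hai, hbi⟩ := Set.mem_iUnion.1 (hcover ▸ Set.mem_univ x)
  have ha : a i = ⊥ := by
    by_contra h
    exact (hx (a i) (by simp [h])).1 hai
  have hb : (b i)ᶜ = ⊥ := by
    by_contra h
    exact (hx (b i)ᶜ (Finset.mem_erase.2 ⟨h, by simp⟩)).2 (compl_le_compl hbi)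
  exact hproper i (by rw [ha, compl_eq_bot.1 hb, Set.Icc_bot_top])
end

section
/- For a Boolean algebra A, the following are equivalent: (i) A is atomic (for every b > ⊥ there is an atom a with a ≤ b); (ii) A is order pre-compact (every ultrafilter on A is order Cauchy); (iii) A is order locally pre-compact (every filter on A that order converges to some element of A contains an order pre-compact subset of A). -/
/-- A filter on a Boolean algebra is order Cauchy if the pushforward of `F ×ˢ F` under
the symmetric difference map order converges to `⊥`. -/
def OrderCauchy {A : Type*} [BooleanAlgebra A] (F : Filter A) : Prop :=
  OrderConvergesTo (Filter.map (fun q : A × A => symmDiff q.1 q.2) (F ×ˢ F)) (⊥ : A)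

/-- A subset of a Boolean algebra is order pre-compact if every ultrafilter containing it
is order Cauchy. -/
def OrderPreCompact {A : Type*} [BooleanAlgebra A] (S : Set A) : Prop :=
  ∀ U : Ultrafilter A, S ∈ U → OrderCauchy (U : Filter A)

/-- In a Boolean algebra all of whose nonzero elements dominate an atom, every ultrafilter is
order Cauchy. -/
theorem orderCauchy_of_atomic {A : Type*} [BooleanAlgebra A]
    (h : ∀ b : A, ⊥ < b → ∃ a : A, IsAtom a ∧ a ≤ b) (U : Ultrafilter A) :
    OrderCauchy (U : Filter A) := by
  refine ⟨{q | ∃ a, IsAtom a ∧ q = (⊥, aᶜ)}, ?_, ?_, ?_⟩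
  · rintro _ ⟨a, -, rfl⟩
    exact bot_le
  · rintro _ ⟨a, ha, rfl⟩
    obtain ⟨M, hM, hMa⟩ : ∃ M ∈ U, ∀ x ∈ M, ∀ y ∈ M, symmDiff x y ≤ aᶜ := by
      by_cases hU : Set.Ici a ∈ U
      · refine ⟨_, hU, fun x hx y hy => ?_⟩
        rw [le_compl_iff_disjoint_left, disjoint_iff, inf_symmDiff_distrib_left,
          inf_eq_left.2 hx, inf_eq_left.2 hy, symmDiff_self]
      · refine ⟨_, Ultrafilter.compl_mem_iff_notMem.2 hU, fun x hx y hy => ?_⟩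
        have key : ∀ z ∈ (Set.Ici a)ᶜ, z ≤ aᶜ := fun z hz =>
          le_compl_iff_disjoint_left.2 ((ha.not_le_iff_disjoint).1 hz)
        exact symmDiff_le_sup.trans (sup_le (key x hx) (key y hy))
    refine Filter.mem_map.2 (Filter.mem_of_superset (Filter.prod_mem_prod hM hM) ?_)
    rintro ⟨x, y⟩ ⟨hx, hy⟩
    exact ⟨bot_le, hMa x hx y hy⟩
  · refine Set.eq_singleton_iff_unique_mem.2 ⟨?_, fun x hx => ?_⟩
    · simp only [Set.mem_iInter]
      rintro _ ⟨a, -, rfl⟩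
      exact ⟨le_rfl, bot_le⟩
    · by_contra hne
      obtain ⟨a, ha, hax⟩ := h x (bot_lt_iff_ne_bot.2 hne)
      have hxa : x ≤ aᶜ := (Set.mem_iInter₂.1 hx (⊥, aᶜ) ⟨a, ha, rfl⟩).2
      exact ha.1 (le_compl_self.1 (hax.trans hxa))

theorem exists_bot_lt_lt_of_not_isAtom {A : Type*} [PartialOrder A] [OrderBot A] {e : A}
    (he : e ≠ ⊥) (h : ¬IsAtom e) : ∃ x, x ≠ ⊥ ∧ x < e := by
  by_contra! hx
  exact h ⟨he, fun x hxe => by_contra fun hne => hx x hne hxe⟩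

/-- Below a nonzero element of an atomless part one finds a nonzero element that covers none of
finitely many prescribed nonzero elements. -/
theorem exists_le_forall_sdiff_ne_bot {A : Type*} [BooleanAlgebra A] {c : A}
    (hc : ∀ e ≤ c, ¬IsAtom e) (L : List A) (hL : ∀ e ∈ L, e ≠ ⊥) {h : A} (hh : h ≠ ⊥)
    (hhc : h ≤ c) : ∃ g ≤ h, g ≠ ⊥ ∧ ∀ e ∈ L, e \ g ≠ ⊥ := by
  induction L with
  | nil => exact ⟨h, le_rfl, hh, by simp⟩
  | cons e L ih =>
    obtain ⟨g, hgh, hg, hgL⟩ := ih fun e he => hL e (List.mem_cons_of_mem _ he)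
    by_cases heg : e \ g = ⊥
    · rw [sdiff_eq_bot_iff] at heg
      obtain ⟨x, hx, hxe⟩ := exists_bot_lt_lt_of_not_isAtom (hL e List.mem_cons_self)
        (hc e (heg.trans (hgh.trans hhc)))
      refine ⟨x, hxe.le.trans (heg.trans hgh), hx, List.forall_mem_cons.2 ⟨?_, fun y hy h0 => ?_⟩⟩
      · rw [Ne, sdiff_eq_bot_iff]
        exact hxe.not_ge
      · exact hgL y hy (le_bot_iff.1 ((sdiff_le_sdiff_left (hxe.le.trans heg)).trans h0.le))
    · exact ⟨g, hgh, hg, List.forall_mem_cons.2 ⟨heg, hgL⟩⟩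

/-- Over an atomless part, some element differs from finitely many prescribed traces
`p.2` on nonzero elements `p.1`, everything being taken outside `r`. -/
theorem exists_forall_inf_sdiff_ne {A : Type*} [BooleanAlgebra A] {c : A}
    (hc : ∀ e ≤ c, ¬IsAtom e) (L : List (A × A)) (hLc : ∀ p ∈ L, p.1 ≤ c) (r : A)
    (hL : ∀ p ∈ L, p.1 \ r ≠ ⊥) : ∃ x, ∀ p ∈ L, (x ⊓ p.1) \ r ≠ p.2 \ r := by
  induction L generalizing r with
  | nil => exact ⟨⊥, by simp⟩
  | cons q L ih =>
    obtain ⟨hqc, hLc⟩ := List.forall_mem_cons.1 hLc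
    obtain ⟨hq, hL⟩ := List.forall_mem_cons.1 hL
    obtain ⟨g, hgq, hg, hgL⟩ := exists_le_forall_sdiff_ne_bot hc (L.map fun p => p.1 \ r)
      (List.forall_mem_map.2 hL) hq (sdiff_le.trans hqc)
    obtain ⟨x, hx⟩ := ih hLc (r ⊔ g) fun p hp => by
      rw [← sdiff_sdiff_left]
      exact hgL _ (List.mem_map_of_mem hp)
    refine ⟨x \ g ⊔ g \ q.2, List.forall_mem_cons.2 ⟨fun h => hg ?_, fun p hp h => hx p hp ?_⟩⟩
    · have hgr : Disjoint g r := disjoint_sdiff_self_left.mono_left hgq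
      have hleft : g ⊓ ((x \ g ⊔ g \ q.2) ⊓ q.1) \ r = g \ q.2 := by
        rw [← inf_sdiff_assoc, inf_comm (x \ g ⊔ g \ q.2), ← inf_assoc,
          inf_eq_left.2 (hgq.trans sdiff_le), inf_sup_left, inf_sdiff_self_right, bot_sup_eq,
          inf_eq_right.2 sdiff_le]
        exact (hgr.mono_left sdiff_le).sdiff_eq_left
      have hright : g ⊓ q.2 \ r = g ⊓ q.2 := by
        rw [← inf_sdiff_assoc, (hgr.mono_left inf_le_left).sdiff_eq_left]
      have heq : g \ q.2 = g ⊓ q.2 := by rw [← hleft, h, hright]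
      have hbot := inf_inf_sdiff g q.2
      rw [heq, inf_idem] at hbot
      rw [← sup_inf_sdiff g q.2, heq, hbot, sup_bot_eq]
    · have hxg : (x \ g ⊔ g \ q.2) \ g = x \ g := by
        rw [sup_sdiff, sdiff_idem, sdiff_eq_bot_iff.2 sdiff_le, sup_bot_eq]
      rw [← sdiff_sdiff_left, ← sdiff_sdiff_left, ← h, sdiff_right_comm, sdiff_right_comm _ r,
        ← sdiff_inf_right_comm x, ← sdiff_inf_right_comm (x \ g ⊔ g \ q.2), hxg]

/-- A nonzero principal ideal without atoms carries an ultrafilter that is not constant on any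
nonzero piece of it. -/
theorem exists_ultrafilter_forall_inf_ne {A : Type*} [BooleanAlgebra A] {c : A}
    (hc : ∀ e ≤ c, ¬IsAtom e) : ∃ U : Ultrafilter A, Set.Iic c ∈ U ∧
      ∀ e ≤ c, e ≠ ⊥ → ∀ z, {x | x ⊓ e ≠ z} ∈ U := by
  classical
  have key (s : Finset (A × A)) :
      ∃ x ≤ c, ∀ p ∈ s, p.1 ≤ c → p.1 ≠ ⊥ → x ⊓ p.1 ≠ p.2 := by
    obtain ⟨x, hx⟩ := exists_forall_inf_sdiff_ne hc (s.filter fun p => p.1 ≤ c ∧ p.1 ≠ ⊥).toList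
      (by simp +contextual) ⊥ (by simp +contextual)
    refine ⟨x ⊓ c, inf_le_right, fun p hp hpc hp0 => ?_⟩
    rw [inf_assoc, inf_eq_right.2 hpc]
    simpa using hx p (by simp [hp, hpc, hp0])
  choose f hfc hf using key
  have hle := Ultrafilter.of_le (Filter.map f Filter.atTop)
  refine ⟨Ultrafilter.of (Filter.map f Filter.atTop),
    hle (Filter.mem_map.2 (Filter.Eventually.of_forall hfc)), fun e hec he z => hle ?_⟩
  refine Filter.mem_map.2 ((Filter.eventually_ge_atTop {(e, z)}).mono fun s hs => ?_)
  exact hf s (e, z) (Finset.singleton_subset_iff.1 hs) hec he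

theorem not_orderPreCompact_of_Iic_subset {A : Type*} [BooleanAlgebra A] {c : A}
    (hc : ∀ e ≤ c, ¬IsAtom e) (hc0 : c ≠ ⊥) {S : Set A} (hS : Set.Iic c ⊆ S) :
    ¬OrderPreCompact S := by
  intro hpre
  obtain ⟨U, hUc, hU⟩ := exists_ultrafilter_forall_inf_ne hc
  obtain ⟨T, -, hT, hTbot⟩ := hpre U (Filter.mem_of_superset hUc hS)
  suffices c ∈ ⋂ q ∈ T, Set.Icc q.1 q.2 from hc0 (by rwa [hTbot] at this)
  refine Set.mem_iInter₂.2 fun q hq => ?_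
  obtain ⟨M, hM, hMq⟩ := Filter.mem_prod_same_iff.1 (Filter.mem_map.1 (hT q hq))
  obtain ⟨y, hy⟩ := U.nonempty_of_mem hM
  have hq1 : q.1 ≤ ⊥ := by simpa using (hMq (Set.mk_mem_prod hy hy)).1
  refine ⟨hq1.trans bot_le, ?_⟩
  by_contra hcq
  have hmem := hU (c \ q.2) sdiff_le (by rwa [Ne, sdiff_eq_bot_iff]) (y ⊓ c \ q.2)
  obtain ⟨x, hx, hxM⟩ := U.nonempty_of_mem (Filter.inter_mem hmem hM)
  refine hx (symmDiff_eq_bot.1 ?_)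
  rw [← inf_symmDiff_distrib_right, ← disjoint_iff]
  exact disjoint_sdiff_self_right.mono_left (hMq (Set.mk_mem_prod hxM hy)).2

/-- Below a nonzero element dominating no atom, some filter order converges to `⊥` while each of
its members contains a nonzero principal ideal. -/
theorem exists_orderConvergesTo_bot {A : Type*} [BooleanAlgebra A] {b : A}
    (hb : ∀ e ≤ b, ¬IsAtom e) (hb0 : b ≠ ⊥) : ∃ F : Filter A, OrderConvergesTo F ⊥ ∧
      ∀ S ∈ F, ∃ c ≤ b, c ≠ ⊥ ∧ Set.Iic c ⊆ S := by
  obtain ⟨J, hJ, -, hdisj⟩ := DistribLattice.prime_ideal_of_disjoint_filter_ideal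
    (F := Order.PFilter.principal b) (I := (⊥ : Order.Ideal A)) (by
      rw [Set.disjoint_left]
      intro x hx hx'
      exact hb0 (le_bot_iff.1 ((Order.PFilter.mem_principal.1 hx).trans hx')))
  have hbJ : b ∉ J := fun h => Set.disjoint_left.1 hdisj (Order.PFilter.mem_principal.2 le_rfl) h
  have hprime (x : A) : x ∈ J ∨ xᶜ ∈ J := hJ.mem_or_compl_mem
  let F : Filter A :=
    { sets := {S | ∃ d ∈ J, Set.Iic dᶜ ⊆ S}
      univ_sets := ⟨⊥, J.bot_mem, Set.subset_univ _⟩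
      sets_of_superset := fun ⟨d, hd, h⟩ hST => ⟨d, hd, h.trans hST⟩
      inter_sets := by
        rintro S T ⟨d, hd, hS⟩ ⟨e, he, hT⟩
        refine ⟨d ⊔ e, Order.Ideal.sup_mem hd he, ?_⟩
        rw [compl_sup, ← Set.Iic_inter_Iic]
        exact Set.inter_subset_inter hS hT }
  refine ⟨F, ⟨{q | ∃ d ∈ J, q = (⊥, dᶜ)}, ?_, ?_, ?_⟩, ?_⟩
  · rintro _ ⟨d, -, rfl⟩
    exact bot_le
  · rintro _ ⟨d, hd, rfl⟩
    exact ⟨d, hd, fun x hx => ⟨bot_le, hx⟩⟩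
  · refine Set.eq_singleton_iff_unique_mem.2 ⟨?_, fun x hx => ?_⟩
    · simp only [Set.mem_iInter]
      rintro _ ⟨d, -, rfl⟩
      exact ⟨le_rfl, bot_le⟩
    · have hxJ (d : A) (hd : d ∈ J) : x ≤ dᶜ := (Set.mem_iInter₂.1 hx (⊥, dᶜ) ⟨d, hd, rfl⟩).2
      have hxb : x ≤ b := by simpa using hxJ bᶜ ((hprime b).resolve_left hbJ)
      by_contra hx0
      obtain ⟨y, hy0, hyx⟩ := exists_bot_lt_lt_of_not_isAtom hx0 (hb x hxb)
      rcases hprime y with hy | hy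
      · exact hy0 (le_compl_self.1 (hyx.le.trans (hxJ y hy)))
      · exact hyx.not_ge (by simpa using hxJ _ hy)
  · rintro S ⟨d, hd, hS⟩
    refine ⟨b \ d, sdiff_le, fun h => hbJ (J.lower (sdiff_eq_bot_iff.1 h) hd), ?_⟩
    rw [sdiff_eq]
    exact (Set.Iic_subset_Iic.2 inf_le_right).trans hS

/-- For a Boolean algebra, atomicity, order pre-compactness, and order local
pre-compactness are all equivalent. -/
theorem booleanAlgebra_atomic_iff_orderPreCompact_iff_locallyPreCompact
    {A : Type*} [BooleanAlgebra A] :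
    List.TFAE
      [∀ b : A, ⊥ < b → ∃ a : A, IsAtom a ∧ a ≤ b,
       OrderPreCompact (Set.univ : Set A),
       ∀ (F : Filter A) (p : A), OrderConvergesTo F p → ∃ S ∈ F, OrderPreCompact S] := by
  tfae_have 1 → 2 := fun h U _ => orderCauchy_of_atomic h U
  tfae_have 2 → 3 := fun h F _ _ => ⟨Set.univ, Filter.univ_mem, h⟩
  tfae_have 3 → 1 := by
    intro h b hb
    by_contra! hno
    have hatom : ∀ e ≤ b, ¬IsAtom e := fun e heb he => hno e he heb
    obtain ⟨F, hF, hmem⟩ := exists_orderConvergesTo_bot hatom hb.ne'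
    obtain ⟨S, hSF, hS⟩ := h F ⊥ hF
    obtain ⟨c, hcb, hc0, hcS⟩ := hmem S hSF
    exact not_orderPreCompact_of_Iic_subset (fun e he => hatom e (he.trans hcb)) hc0 hcS hS
  tfae_finish
end

section
/- For a Boolean algebra A, the following are equivalent: (i) A is a complete lattice and atomic; (ii) A is order compact (every ultrafilter on A order converges to some element of A); (iii) A is order locally compact (every filter on A that order converges to some element contains an order compact subset of A). -/
/-- A subset `S` is order compact if every ultrafilter containing `S` order converges
to some element of `S`. -/
def OrderCompact {A : Type*} [Lattice A] (S : Set A) : Prop :=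
  ∀ U : Ultrafilter A, S ∈ U → ∃ p ∈ S, OrderConvergesTo (U : Filter A) p

section Lattice

open Filter Set

variable {P : Type*} [Lattice P] {F : Filter P} [F.NeBot] {p u : P}

theorem OrderConvergesTo.le_of_Iic_mem (h : OrderConvergesTo F p) (hu : Iic u ∈ F) : p ≤ u := by
  obtain ⟨S, -, hS, hp⟩ := h
  have hpS : p ∈ ⋂ q ∈ S, Icc q.1 q.2 := hp ▸ rfl
  have : u ⊓ p ∈ ⋂ q ∈ S, Icc q.1 q.2 := by
    simp only [mem_iInter, mem_Icc] at hpS ⊢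
    intro q hq
    obtain ⟨x, hx, hxu⟩ := F.nonempty_of_mem (inter_mem (hS q hq) hu)
    exact ⟨le_inf (hx.1.trans hxu) (hpS q hq).1, inf_le_right.trans (hpS q hq).2⟩
  rw [hp, mem_singleton_iff] at this
  exact inf_eq_right.1 this

theorem OrderConvergesTo.le_of_Ici_mem (h : OrderConvergesTo F p) (hu : Ici u ∈ F) : u ≤ p := by
  obtain ⟨S, -, hS, hp⟩ := h
  have hpS : p ∈ ⋂ q ∈ S, Icc q.1 q.2 := hp ▸ rfl
  have : u ⊔ p ∈ ⋂ q ∈ S, Icc q.1 q.2 := by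
    simp only [mem_iInter, mem_Icc] at hpS ⊢
    intro q hq
    obtain ⟨x, hx, hxu⟩ := F.nonempty_of_mem (inter_mem (hS q hq) hu)
    exact ⟨(hpS q hq).1.trans le_sup_right, sup_le (le_trans hxu hx.2) (hpS q hq).2⟩
  rw [hp, mem_singleton_iff] at this
  exact sup_eq_right.1 this

end Lattice

section BooleanAlgebra

open Filter Set

variable {A : Type*} [BooleanAlgebra A] {b w : A}

/-- If the ultrafilters containing `Iic w` order converge, then subsets of `Iic w` have suprema. -/
theorem exists_isLUB_of_orderConvergesTo
    (H : ∀ U : Ultrafilter A, Iic w ∈ U → ∃ p, OrderConvergesTo (U : Filter A) p)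
    {S : Set A} (hS : S ⊆ Iic w) : ∃ a, IsLUB S a := by
  classical
  let f : Finset S → A := fun t => t.sup Subtype.val
  let U : Ultrafilter A := Ultrafilter.of (map f atTop)
  have hU : ∀ {s : Set A}, s ∈ map f atTop → s ∈ (U : Filter A) := fun h => Ultrafilter.of_le _ h
  have hub : ∀ u ∈ upperBounds S, Iic u ∈ (U : Filter A) := fun u hu =>
    hU (mem_map.2 (univ_mem' fun t => Finset.sup_le fun s _ => hu s.2))
  obtain ⟨p, hp⟩ := H U (hub w fun s hs => hS hs)
  refine ⟨p, fun s hs => hp.le_of_Ici_mem (hU ?_), fun u hu => hp.le_of_Iic_mem (hub u hu)⟩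
  rw [mem_map]
  filter_upwards [mem_atTop ({⟨s, hs⟩} : Finset S)] with t ht
  exact Finset.le_sup (f := Subtype.val) (ht (Finset.mem_singleton_self _))

theorem exists_lt_of_not_isAtom {P : Type*} [PartialOrder P] [OrderBot P] {e : P} (he : e ≠ ⊥)
    (h : ¬ IsAtom e) : ∃ z, z ≠ ⊥ ∧ z < e := by
  simp only [IsAtom, not_and, not_forall] at h
  obtain ⟨z, hz, hz'⟩ := h he
  exact ⟨z, hz', hz⟩

theorem exists_le_forall_not_le_of_atomless {P : Type*} [PartialOrder P] [OrderBot P] {b e : P}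
    (hb : ∀ a ≤ b, ¬ IsAtom a) (he : e ≠ ⊥) (heb : e ≤ b) (E : Finset P) (hE : ∀ x ∈ E, x ≠ ⊥) :
    ∃ z ≤ e, z ≠ ⊥ ∧ ∀ x ∈ E, ¬ x ≤ z := by
  classical
  induction E using Finset.induction_on with
  | empty => exact ⟨e, le_rfl, he, by simp⟩
  | insert y E _ ih =>
    simp only [Finset.forall_mem_insert] at hE ⊢
    obtain ⟨z, hze, hz, hzE⟩ := ih hE.2
    by_cases hyz : y ≤ z
    · obtain ⟨t, ht, hty⟩ := exists_lt_of_not_isAtom hE.1 (hb y (hyz.trans (hze.trans heb)))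
      exact ⟨t, hty.le.trans (hyz.trans hze), ht, hty.not_ge,
        fun x hx hxt => hzE x hx (hxt.trans (hty.le.trans hyz))⟩
    · exact ⟨z, hze, hz, hyz, hzE⟩

/-- Finitely many nonzero elements of an atomless Boolean algebra are split by one element. -/
theorem exists_forall_not_le_and_not_le_compl_of_atomless (hb : ∀ a ≤ b, ¬ IsAtom a)
    (E : Finset A) (hE : ∀ e ∈ E, e ≠ ⊥ ∧ e ≤ b) :
    ∃ x : A, ∀ e ∈ E, ¬ e ≤ x ∧ ¬ e ≤ xᶜ := by
  classical
  induction E using Finset.induction_on with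
  | empty => simp
  | insert e E _ ih =>
    simp only [Finset.forall_mem_insert] at hE ⊢
    obtain ⟨⟨he, heb⟩, hE⟩ := hE
    have key : ∀ x : A, (∀ e ∈ E, ¬ e ≤ x ∧ ¬ e ≤ xᶜ) → e ≤ x →
        ∃ x : A, (¬ e ≤ x ∧ ¬ e ≤ xᶜ) ∧ ∀ e ∈ E, ¬ e ≤ x ∧ ¬ e ≤ xᶜ := by
      intro x hx hex
      obtain ⟨z, hze, hz, hzE⟩ := exists_le_forall_not_le_of_atomless hb he heb
        (insert e (E.image (x ⊓ ·))) (by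
          simp only [Finset.forall_mem_insert, Finset.forall_mem_image]
          refine ⟨he, fun y hy h => (hx y hy).2 ?_⟩
          exact le_compl_iff_disjoint_left.2 (disjoint_iff.2 h))
      simp only [Finset.forall_mem_insert, Finset.forall_mem_image] at hzE
      have hcompl : (x \ z)ᶜ = xᶜ ⊔ z := by rw [_root_.sdiff_eq, compl_inf, compl_compl]
      have hcompl' : ∀ y, y ≤ (x \ z)ᶜ → x ⊓ y ≤ z := by
        intro y hy
        rw [hcompl] at hy
        calc x ⊓ y ≤ x ⊓ (xᶜ ⊔ z) := inf_le_inf_left _ hy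
          _ ≤ z := by rw [inf_sup_left, inf_compl_self, bot_sup_eq]; exact inf_le_right
      refine ⟨x \ z, ⟨fun h => hz ?_, fun h => hzE.1 ?_⟩,
        fun y hy => ⟨fun h => (hx y hy).1 (h.trans sdiff_le), fun h => hzE.2 hy (hcompl' y h)⟩⟩
      · exact disjoint_self.1 (disjoint_sdiff_self_left.mono_left (hze.trans h))
      · simpa [inf_eq_right.2 hex] using hcompl' e h
    obtain ⟨x, hx⟩ := ih hE
    by_cases h₁ : e ≤ x
    · exact key x hx h₁
    by_cases h₂ : e ≤ xᶜ
    · exact key xᶜ (fun y hy => by simpa [and_comm] using hx y hy) h₂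
    · exact ⟨x, ⟨h₁, h₂⟩, hx⟩

/-- If the ultrafilters containing `Iic b` order converge, then `b` dominates an atom. -/
theorem exists_isAtom_le_of_orderConvergesTo
    (H : ∀ U : Ultrafilter A, Iic b ∈ U → ∃ p, OrderConvergesTo (U : Filter A) p)
    (hb₀ : b ≠ ⊥) : ∃ a, IsAtom a ∧ a ≤ b := by
  classical
  by_contra! hb
  replace hb : ∀ a ≤ b, ¬ IsAtom a := fun a hab ha => hb a ha hab
  obtain ⟨U, hU⟩ := Ultrafilter.exists_ultrafilter_of_finite_inter_nonempty
    ((fun e : A => {x | x ≤ b ∧ ¬ e ≤ x ∧ ¬ e ≤ xᶜ}) '' {e | e ≠ ⊥ ∧ e ≤ b}) (by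
      intro T hT
      obtain ⟨E, hE, rfl⟩ := Finset.subset_set_image_iff.1 hT
      obtain ⟨x, hx⟩ := exists_forall_not_le_and_not_le_compl_of_atomless hb E fun e he => hE he
      refine ⟨x ⊓ b, ?_⟩
      simp only [Finset.coe_image, sInter_image, mem_iInter, Finset.mem_coe]
      intro e he
      refine ⟨inf_le_right, fun h => (hx e he).1 (h.trans inf_le_left), fun h => (hx e he).2 ?_⟩
      rw [le_compl_iff_disjoint_right] at h ⊢
      rw [disjoint_iff] at h ⊢
      rwa [inf_comm x, ← inf_assoc, inf_eq_left.2 (hE he).2] at h)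
  replace hU : ∀ e, e ≠ ⊥ → e ≤ b → {x | x ≤ b ∧ ¬ e ≤ x ∧ ¬ e ≤ xᶜ} ∈ (U : Filter A) :=
    fun e he heb => hU ⟨e, ⟨he, heb⟩, rfl⟩
  obtain ⟨p, S, -, hS, hp⟩ := H U (mem_of_superset (hU b hb₀ le_rfl) fun x hx => hx.1)
  have hfst : ∀ q ∈ S, q.1 = ⊥ := by
    intro q hq
    by_contra hne
    have hqb : q.1 ≤ b := by
      obtain ⟨x, hx, hxb⟩ := U.nonempty_of_mem (inter_mem (hS q hq) (hU b hb₀ le_rfl))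
      exact hx.1.trans hxb.1
    obtain ⟨x, hx, hxe⟩ := U.nonempty_of_mem (inter_mem (hS q hq) (hU _ hne hqb))
    exact hxe.2.1 hx.1
  have hsnd : ∀ q ∈ S, b ≤ q.2 := by
    intro q hq
    by_contra hne
    obtain ⟨x, hx, hxe⟩ := U.nonempty_of_mem (inter_mem (hS q hq)
      (hU (b \ q.2) (fun h => hne (sdiff_eq_bot_iff.1 h)) sdiff_le))
    exact hxe.2.2 (_root_.sdiff_eq (x := b) ▸ inf_le_right.trans (compl_le_compl hx.2))
  have hmem : ∀ x ≤ b, x ∈ ⋂ q ∈ S, Icc q.1 q.2 := fun x hx =>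
    mem_iInter₂.2 fun q hq => ⟨(hfst q hq).trans_le bot_le, hx.trans (hsnd q hq)⟩
  rw [hp] at hmem
  exact hb₀ ((hmem b le_rfl).trans (hmem ⊥ bot_le).symm)

/-- `Iic w` is relatively complete and atomic. -/
def IsCompleteAtomicBelow (w : A) : Prop :=
  (∀ S ⊆ Iic w, ∃ a, IsLUB S a) ∧ ∀ b ≤ w, b ≠ ⊥ → ∃ a, IsAtom a ∧ a ≤ b

theorem isCompleteAtomicBelow_of_orderConvergesTo
    (H : ∀ U : Ultrafilter A, Iic w ∈ U → ∃ p, OrderConvergesTo (U : Filter A) p) :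
    IsCompleteAtomicBelow w :=
  ⟨fun _ hS => exists_isLUB_of_orderConvergesTo H hS, fun _ hb hb₀ =>
    exists_isAtom_le_of_orderConvergesTo
      (fun U hU => H U (mem_of_superset hU (Iic_subset_Iic.2 hb))) hb₀⟩

theorem IsAtom.isCompleteAtomicBelow {a : A} (ha : IsAtom a) : IsCompleteAtomicBelow a := by
  constructor
  · intro S hS
    by_cases haS : a ∈ S
    · exact ⟨a, fun s hs => hS hs, fun u hu => hu haS⟩
    · refine ⟨⊥, fun s hs => ?_, fun u _ => bot_le⟩
      rcases ha.le_iff.1 (hS hs) with rfl | rfl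
      · exact le_rfl
      · exact absurd hs haS
  · intro b hb hb₀
    rcases ha.le_iff.1 hb with rfl | rfl
    · exact absurd rfl hb₀
    · exact ⟨b, ha, le_rfl⟩

theorem IsCompleteAtomicBelow.mono {v : A} (h : IsCompleteAtomicBelow w) (hv : v ≤ w) :
    IsCompleteAtomicBelow v :=
  ⟨fun S hS => h.1 S (hS.trans (Iic_subset_Iic.2 hv)), fun b hb => h.2 b (hb.trans hv)⟩

theorem IsCompleteAtomicBelow.sup {v : A} (hv : IsCompleteAtomicBelow v)
    (hw : IsCompleteAtomicBelow w) : IsCompleteAtomicBelow (v ⊔ w) := by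
  constructor
  · intro S hS
    obtain ⟨c, hc⟩ := hv.1 ((· ⊓ v) '' S) (by rintro _ ⟨s, -, rfl⟩; exact inf_le_right)
    obtain ⟨d, hd⟩ := hw.1 ((· ⊓ w) '' S) (by rintro _ ⟨s, -, rfl⟩; exact inf_le_right)
    refine ⟨c ⊔ d, fun s hs => ?_, fun u hu => sup_le (hc.2 ?_) (hd.2 ?_)⟩
    · rw [← inf_eq_left.2 (hS hs), inf_sup_left]
      exact sup_le_sup (hc.1 ⟨s, hs, rfl⟩) (hd.1 ⟨s, hs, rfl⟩)
    all_goals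
      rintro _ ⟨s, hs, rfl⟩
      exact inf_le_left.trans (hu hs)
  · intro b hb hb₀
    by_cases hbv : b ⊓ v = ⊥
    · obtain ⟨a, ha, hab⟩ := hw.2 (b ⊓ w) inf_le_right fun h => hb₀ (by
        rw [← inf_eq_left.2 hb, inf_sup_left, hbv, h, bot_sup_eq])
      exact ⟨a, ha, hab.trans inf_le_left⟩
    · obtain ⟨a, ha, hab⟩ := hv.2 (b ⊓ v) inf_le_right hbv
      exact ⟨a, ha, hab.trans inf_le_left⟩

/-- The ideal of elements below which the algebra is complete and atomic. -/
def completeAtomicIdeal (A : Type*) [BooleanAlgebra A] : Order.Ideal A where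
  carrier := {w | IsCompleteAtomicBelow w}
  lower' _ _ hv hw := IsCompleteAtomicBelow.mono hw hv
  nonempty' := ⟨⊥, fun _ hS => ⟨⊥, hS, fun _ _ => bot_le⟩,
    fun _ hb hb₀ => absurd (le_bot_iff.1 hb) hb₀⟩
  directed' v hv w hw := ⟨v ⊔ w, hv.sup hw, le_sup_left, le_sup_right⟩

theorem orderConvergesTo_of_complete_atomic (hA : ∀ S : Set A, ∃ a : A, IsLUB S a)
    (hat : ∀ b : A, ⊥ < b → ∃ a : A, IsAtom a ∧ a ≤ b) (U : Ultrafilter A) :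
    ∃ p, OrderConvergesTo (U : Filter A) p := by
  obtain ⟨p, hp⟩ := hA {a | IsAtom a ∧ Ici a ∈ U}
  refine ⟨p, {q | Icc q.1 q.2 ∈ U ∧ q.1 ≤ p ∧ p ≤ q.2}, fun q hq => hq.2.1.trans hq.2.2,
    fun q hq => hq.1, ?_⟩
  refine subset_antisymm (fun x hx => ?_) ?_
  · simp only [mem_iInter] at hx
    refine le_antisymm ?_ (hp.2 fun a ha => ?_)
    · by_contra hxp
      obtain ⟨a, ha, hax⟩ := hat (x \ p) (bot_lt_iff_ne_bot.2 fun h => hxp (sdiff_eq_bot_iff.1 h))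
      have hap : ¬ a ≤ p := fun h =>
        ha.1 (disjoint_self.1 ((disjoint_sdiff_self_left (x := p) (y := x)).mono hax h))
      have haU : Ici a ∉ U := fun h => hap (hp.1 ⟨ha, h⟩)
      have hcU : Icc ⊥ aᶜ ∈ U := by
        filter_upwards [Ultrafilter.compl_mem_iff_notMem.2 haU] with y hy
        exact ⟨bot_le, le_compl_iff_disjoint_left.2 (ha.not_le_iff_disjoint.1 hy)⟩
      have hpa : p ≤ aᶜ := le_compl_iff_disjoint_left.2 (ha.not_le_iff_disjoint.1 hap)
      have hxa := (hx (⊥, aᶜ) ⟨hcU, bot_le, hpa⟩).2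
      exact ha.1 (disjoint_self.1 ((le_compl_iff_disjoint_left.1 hxa).mono_right
        (hax.trans sdiff_le)))
    · exact (hx (a, ⊤) ⟨by simpa using ha.2, hp.1 ha, le_top⟩).1
  · rintro x rfl
    simp only [mem_iInter]
    exact fun q hq => hq.2

theorem isCompleteAtomicBelow_top_of_locallyCompact
    (H : ∀ (F : Filter A) (p : A), OrderConvergesTo F p → ∃ S ∈ F, OrderCompact S) :
    IsCompleteAtomicBelow (⊤ : A) := by
  by_contra htop
  obtain ⟨J, hJ, hIJ, hJtop⟩ := DistribLattice.prime_ideal_of_disjoint_filter_ideal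
    (F := Order.PFilter.principal (⊤ : A)) (I := completeAtomicIdeal A) (by
      rw [Set.disjoint_left]
      intro x hx hxI
      obtain rfl : x = ⊤ := top_le_iff.1 (by simpa using hx)
      exact htop hxI)
  have hlub : ∀ x : A, (∀ j ∈ J, Disjoint x j) → x = ⊥ := by
    intro x hx
    by_contra hx₀
    have hatom : IsAtom x := ⟨hx₀, fun y hy => by
      rcases hJ.mem_or_compl_mem (x := y) with h | h
      · exact disjoint_self.1 ((hx y h).mono_left hy.le)
      · exact absurd (disjoint_compl_right_iff.1 (hx _ h)) hy.not_ge⟩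
    exact hx₀ (disjoint_self.1 (hx x (hIJ hatom.isCompleteAtomicBelow)))
  have hdir : DirectedOn (Order.Preimage (fun j : A => Iic jᶜ) (· ≥ ·)) (J : Set A) := fun i hi j hj =>
    ⟨i ⊔ j, J.sup_mem hi hj, Iic_subset_Iic.2 (compl_le_compl le_sup_left),
      Iic_subset_Iic.2 (compl_le_compl le_sup_right)⟩
  have hbasis := hasBasis_biInf_principal hdir J.nonempty
  obtain ⟨S, hS, hScomp⟩ := H (⨅ j ∈ (J : Set A), 𝓟 (Iic jᶜ)) ⊥
    ⟨(fun j => (⊥, jᶜ)) '' (J : Set A), by simp, by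
      rintro _ ⟨j, hj, rfl⟩
      simpa using hbasis.mem_of_mem hj, by
      ext x
      simp only [biInter_image, mem_iInter, mem_Icc, bot_le, true_and, mem_singleton_iff]
      exact ⟨fun h => hlub x fun j hj => le_compl_iff_disjoint_right.1 (h j hj),
        fun h j _ => h ▸ bot_le⟩⟩
  obtain ⟨j, hj, hjS⟩ := hbasis.mem_iff.1 hS
  have hjc : jᶜ ∈ J := hIJ (isCompleteAtomicBelow_of_orderConvergesTo fun U hU =>
    (hScomp U (mem_of_superset hU hjS)).imp fun _ h => h.2)
  have : (⊤ : A) ∈ J := sup_compl_eq_top (x := j) ▸ J.sup_mem hj hjc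
  exact Set.disjoint_left.1 hJtop (by simp) this

end BooleanAlgebra

/-- For a Boolean algebra, being complete and atomic, being order compact,
and being order locally compact are all equivalent. -/
theorem booleanAlgebra_completeAtomic_iff_orderCompact_iff_locallyCompact
    {A : Type*} [BooleanAlgebra A] :
    List.TFAE
      [(∀ S : Set A, ∃ a : A, IsLUB S a) ∧ (∀ b : A, ⊥ < b → ∃ a : A, IsAtom a ∧ a ≤ b),
       OrderCompact (Set.univ : Set A),
       ∀ (F : Filter A) (p : A), OrderConvergesTo F p → ∃ S ∈ F, OrderCompact S] := by
  tfae_have 1 → 2 := fun h U _ =>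
    (orderConvergesTo_of_complete_atomic h.1 h.2 U).imp fun p hp => ⟨Set.mem_univ p, hp⟩
  tfae_have 2 → 3 := fun h _ _ _ => ⟨Set.univ, Filter.univ_mem, h⟩
  tfae_have 3 → 1 := fun h =>
    have hA := isCompleteAtomicBelow_top_of_locallyCompact h
    ⟨fun S => hA.1 S fun _ _ => le_top, fun b hb => hA.2 b le_top hb.ne'⟩
  tfae_finish
end

section
/- Let A be a Boolean algebra. Order convergence on A is topological, meaning there exists a topology τ on A such that for every filter F on A and every p ∈ A, F order converges to p if and only if F contains the τ-neighborhood filter of p, if and only if A is atomic (every b > ⊥ dominates an atom). -/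
/-- On an atomic Boolean algebra, order convergence to `p` says that membership of each atom is
eventually decided as it is for `p`. -/
theorem orderConvergesTo_iff_forall_isAtom {A : Type*} [BooleanAlgebra A]
    (hA : ∀ b : A, ⊥ < b → ∃ a : A, IsAtom a ∧ a ≤ b) (F : Filter A) (p : A) :
    OrderConvergesTo F p ↔ ∀ a : A, IsAtom a → ∀ᶠ x in F, (a ≤ x ↔ a ≤ p) := by
  constructor
  · rintro ⟨S, -, hF, hS⟩ a ha
    have key : ∀ x, (∀ q ∈ S, q.1 ≤ x ∧ x ≤ q.2) ↔ x = p := fun x => by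
      simpa using Set.ext_iff.1 hS x
    have hp := (key p).2 rfl
    by_cases hap : a ≤ p
    · obtain ⟨q, hq, haq⟩ : ∃ q ∈ S, a ≤ q.1 := by
        by_contra! hne
        have hd : p \ a = p := (key _).1 fun q hq =>
          ⟨le_sdiff.2 ⟨(hp q hq).1, (ha.not_le_iff_disjoint.1 (hne q hq)).symm⟩,
            sdiff_le.trans (hp q hq).2⟩
        exact ha.1 ((sdiff_eq_left.1 hd).symm.eq_bot_of_le hap)
      filter_upwards [hF q hq] with x hx
      exact iff_of_true (haq.trans hx.1) hap
    · obtain ⟨q, hq, haq⟩ : ∃ q ∈ S, ¬ a ≤ q.2 := by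
        by_contra! hne
        have hs : p ⊔ a = p := (key _).1 fun q hq =>
          ⟨(hp q hq).1.trans le_sup_left, sup_le (hp q hq).2 (hne q hq)⟩
        exact hap (sup_eq_left.1 hs)
      filter_upwards [hF q hq] with x hx
      exact iff_of_false (fun h => haq (h.trans hx.2)) hap
  · intro h
    have le_of_atoms : ∀ x y : A, (∀ a, IsAtom a → a ≤ x → a ≤ y) → x ≤ y := by
      intro x y hxy
      by_contra hne
      obtain ⟨a, ha, hle⟩ := hA (x \ y) (bot_lt_iff_ne_bot.2 fun h0 => hne (sdiff_eq_bot_iff.1 h0))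
      obtain ⟨hax, hay⟩ := le_sdiff.1 hle
      exact ha.1 (hay.eq_bot_of_le (hxy a ha hax))
    refine ⟨{q | (IsAtom q.1 ∧ q.1 ≤ p ∧ q.2 = ⊤) ∨
      ∃ a, IsAtom a ∧ ¬ a ≤ p ∧ q.1 = ⊥ ∧ q.2 = aᶜ}, ?_, ?_, ?_⟩
    · rintro ⟨l, u⟩ (⟨-, -, rfl⟩ | ⟨a, -, -, rfl, rfl⟩)
      exacts [le_top, bot_le]
    · rintro ⟨l, u⟩ (⟨ha, hap, rfl⟩ | ⟨a, ha, hap, rfl, rfl⟩)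
      · filter_upwards [h l ha] with x hx
        exact ⟨hx.2 hap, le_top⟩
      · filter_upwards [h a ha] with x hx
        exact ⟨bot_le, (ha.not_le_iff_disjoint.1 fun hax => hap (hx.1 hax)).symm.le_compl_right⟩
    · ext x
      simp only [Set.mem_iInter, Set.mem_singleton_iff]
      constructor
      · intro hx
        refine le_antisymm (le_of_atoms _ _ fun a ha hax => ?_) (le_of_atoms _ _ fun a ha hap => ?_)
        · by_contra hap
          have hxa : x ≤ aᶜ := (hx (⊥, aᶜ) (Or.inr ⟨a, ha, hap, rfl, rfl⟩)).2
          exact ha.1 (le_compl_self.1 (hax.trans hxa))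
        · exact (hx (a, ⊤) (Or.inl ⟨ha, hap, rfl⟩)).1
      · rintro rfl ⟨l, u⟩ (⟨ha, hap, rfl⟩ | ⟨a, ha, hap, rfl, rfl⟩)
        · exact ⟨hap, le_top⟩
        · exact ⟨bot_le, (ha.not_le_iff_disjoint.1 hap).symm.le_compl_right⟩

/-- If no atom lies below `c`, where `c ≠ ⊥`, then some filter order converges to `⊥` while
containing no initial segment `[⊥, u]` with `u` disjoint from `c`. -/
theorem exists_orderConvergesTo_bot_of_forall_not_isAtom {A : Type*} [BooleanAlgebra A] {c : A}
    (hc : c ≠ ⊥) (hatom : ∀ a : A, IsAtom a → ¬ a ≤ c) :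
    ∃ F : Filter A, OrderConvergesTo F ⊥ ∧ ∀ u : A, Disjoint c u → Set.Iic u ∉ F := by
  obtain ⟨J, hJ, -, hcJ⟩ := DistribLattice.prime_ideal_of_disjoint_filter_ideal
    (F := Order.PFilter.principal c) (I := Order.Ideal.principal (⊥ : A)) (by
      rw [Set.disjoint_left]
      rintro x hx hx'
      exact hc (le_bot_iff.1 ((Order.PFilter.mem_principal.1 hx).trans
        (Order.Ideal.mem_principal.1 hx'))))
  have hcJ : c ∉ J := fun h => Set.disjoint_left.1 hcJ (Order.PFilter.mem_principal.2 le_rfl) h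
  have hmem : ∀ s : Set A, s ∈ (⨅ g ∈ {g : A | g ∉ J}, Filter.principal (Set.Iic g)) ↔
      ∃ g ∉ J, Set.Iic g ⊆ s := by
    intro s
    rw [Filter.mem_biInf_of_directed _ ⟨c, hcJ⟩]
    · simp
    · intro g hg h hh
      refine ⟨g ⊓ h, fun hgh => (hJ.mem_or_mem hgh).elim hg hh, ?_, ?_⟩ <;> simp
  refine ⟨⨅ g ∈ {g : A | g ∉ J}, Filter.principal (Set.Iic g),
    ⟨{q | q.1 = ⊥ ∧ q.2 ∉ J}, ?_, ?_, ?_⟩, fun u hu hF => ?_⟩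
  · rintro ⟨l, u⟩ ⟨rfl, -⟩
    exact bot_le
  · rintro ⟨l, u⟩ ⟨rfl, hu⟩
    exact (hmem _).2 ⟨u, hu, fun x hx => ⟨bot_le, hx⟩⟩
  · ext x
    simp only [Set.mem_iInter, Set.mem_singleton_iff]
    constructor
    · intro hx
      have hle : ∀ g ∉ J, x ≤ g := fun g hg => (hx (⊥, g) ⟨rfl, hg⟩).2
      by_contra hx0
      refine hatom x ⟨hx0, fun y hy => ?_⟩ (hle c hcJ)
      have hyJ : y ∈ J := by
        by_contra hyJ
        exact hy.not_ge (hle y hyJ)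
      have hycJ : yᶜ ∉ J := fun h =>
        hcJ (J.lower le_top (sup_compl_eq_top (x := y) ▸ J.sup_mem hyJ h))
      exact le_compl_self.1 (hy.le.trans (hle _ hycJ))
    · rintro rfl ⟨l, u⟩ ⟨rfl, -⟩
      exact ⟨le_rfl, bot_le⟩
  · obtain ⟨g, hg, hgu⟩ := (hmem _).1 hF
    have hle : g ≤ u := hgu le_rfl
    have hgc : g ⊓ c ∈ J := by
      rw [((hu.mono_right hle).symm).eq_bot]
      exact J.bot_mem
    exact (hJ.mem_or_mem hgc).elim hg hcJ

/-- Order convergence on a Boolean algebra is topological iff the Boolean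
algebra is atomic. -/
theorem booleanAlgebra_orderConvergence_topological_iff_atomic
    {A : Type*} [BooleanAlgebra A] :
    (∃ τ : TopologicalSpace A, ∀ (F : Filter A) (p : A),
        OrderConvergesTo F p ↔ F ≤ @nhds A τ p) ↔
      (∀ b : A, ⊥ < b → ∃ a : A, IsAtom a ∧ a ≤ b) := by
  constructor
  · rintro ⟨τ, hτ⟩ b hb
    by_contra! hne
    obtain ⟨S, -, hN, hS⟩ := (hτ _ ⊥).2 le_rfl
    have key : ∀ x, (∀ q ∈ S, q.1 ≤ x ∧ x ≤ q.2) ↔ x = ⊥ := fun x => by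
      simpa using Set.ext_iff.1 hS x
    have hbot := (key ⊥).2 rfl
    obtain ⟨q, hq, hbq⟩ : ∃ q ∈ S, ¬ b ≤ q.2 := by
      by_contra! h
      exact hb.ne' ((key b).1 fun q hq => ⟨(hbot q hq).1.trans bot_le, h q hq⟩)
    obtain ⟨F, hF, hFu⟩ := exists_orderConvergesTo_bot_of_forall_not_isAtom (c := b \ q.2)
      (fun h => hbq (sdiff_eq_bot_iff.1 h)) fun a ha hle => hne a ha (hle.trans sdiff_le)
    exact hFu q.2 disjoint_sdiff_self_left
      (Filter.mem_of_superset ((hτ F ⊥).1 hF (hN q hq)) fun x hx => hx.2)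
  · classical
    intro hA
    let f : A → {a : A // IsAtom a} → Bool := fun x a => decide (a.1 ≤ x)
    refine ⟨TopologicalSpace.induced f inferInstance, fun F p => ?_⟩
    rw [orderConvergesTo_iff_forall_isAtom hA, nhds_induced, ← Filter.map_le_iff_le_comap]
    change _ ↔ Filter.Tendsto f F (nhds (f p))
    simp [tendsto_pi_nhds, nhds_discrete, Filter.tendsto_pure, f]
end

section
/- Let K be a compact Hausdorff topological space with no isolated points, and let F be a linear sublattice of C(K,ℝ) (a linear subspace closed under the pointwise lattice operations ⊔ and ⊓) which is dense in the supremum norm. Let P = {h ∈ F : 0 ≤ h ≤ 1 pointwise}. If P equals a finite union of sets of the form {h ∈ P : eᵢ ≤ h ≤ fᵢ} with eᵢ, fᵢ ∈ P, eᵢ ≤ fᵢ, then one of these sets equals P. In other words, P cannot be covered by finitely many proper order intervals of P. -/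
/-- Finitely many infinite sets admit a system of distinct representatives. -/
theorem exists_injective_mem_of_forall_infinite {ι α : Type*} [Fintype ι] (U : ι → Set α)
    (hU : ∀ i, (U i).Infinite) : ∃ x : ι → α, Function.Injective x ∧ ∀ i, x i ∈ U i := by
  classical
  choose T hTU hT using fun i => (hU i).exists_subset_card_eq (Fintype.card ι)
  obtain ⟨x, hx, hxT⟩ := (Finset.all_card_le_biUnion_card_iff_exists_injective T).1 fun s => by
    rcases s.eq_empty_or_nonempty with rfl | ⟨i, hi⟩
    · simp
    · calc s.card ≤ Fintype.card ι := s.card_le_univ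
        _ = (T i).card := (hT i).symm
        _ ≤ (s.biUnion T).card := Finset.card_le_card (Finset.subset_biUnion_of_mem T hi)
  exact ⟨x, hx, fun i => hTU i (hxT i)⟩

/-- A dense sup-closed subspace of `C(K, ℝ)` contains functions with values in `[0, 1]` which are
almost `0` on one closed set and almost `1` on a disjoint one. -/
theorem exists_mem_unitInterval_le_and_ge_of_dense
    {K : Type*} [TopologicalSpace K] [CompactSpace K] [T2Space K]
    (F : Submodule ℝ C(K, ℝ))
    (hsup : ∀ f g : C(K, ℝ), f ∈ F → g ∈ F → f ⊔ g ∈ F)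
    (hdense : Dense (F : Set C(K, ℝ))) {A B : Set K} (hA : IsClosed A) (hB : IsClosed B)
    (hAB : Disjoint A B) {δ : ℝ} (hδ : 0 < δ) :
    ∃ h ∈ F, 0 ≤ h ∧ h ≤ 1 ∧ (∀ x ∈ A, h x ≤ δ) ∧ ∀ x ∈ B, 1 - 2 * δ ≤ h x := by
  obtain ⟨g, hgA, hgB, hg⟩ := exists_continuous_zero_one_of_isClosed hA hB hAB
  obtain ⟨u, huF, hu⟩ := hdense.exists_dist_lt (g - ContinuousMap.const K δ) hδ
  have key : ∀ x, |g x - δ - u x| < δ := fun x =>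
    (ContinuousMap.dist_apply_le_dist (f := g - ContinuousMap.const K δ) (g := u) x).trans_lt hu
  refine ⟨u ⊔ 0, hsup _ _ huF F.zero_mem, le_sup_right, ?_, ?_, ?_⟩
  · refine sup_le (fun x => ?_) (fun x => zero_le_one)
    have := abs_lt.1 (key x)
    change u x ≤ 1
    linarith [(hg x).2]
  · intro x hx
    have := abs_lt.1 (key x)
    have h0 : g x = 0 := hgA hx
    exact sup_le (by linarith) hδ.le
  · intro x hx
    have := abs_lt.1 (key x)
    have h1 : g x = 1 := hgB hx
    exact le_sup_of_le_left (by linarith)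

/-- Let `K` be a compact Hausdorff space with no isolated points and `F` a
norm-dense linear sublattice of `C(K, ℝ)`. Then `P = F ∩ [0, 1]` cannot be covered by
finitely many proper order intervals of `P`: if `P` is a finite union of sets
`{h ∈ P : eᵢ ≤ h ≤ fᵢ}` with `eᵢ, fᵢ ∈ P`, then one of these sets is all of `P`. -/
theorem denseSublattice_unitInterval_not_finite_union_of_proper_intervals
    {K : Type*} [TopologicalSpace K] [CompactSpace K] [T2Space K]
    (hK : ∀ x : K, ¬ IsOpen ({x} : Set K))
    (F : Submodule ℝ C(K, ℝ))
    (hsup : ∀ f g : C(K, ℝ), f ∈ F → g ∈ F → f ⊔ g ∈ F)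
    (hinf : ∀ f g : C(K, ℝ), f ∈ F → g ∈ F → f ⊓ g ∈ F)
    (hdense : Dense (F : Set C(K, ℝ)))
    (P : Set C(K, ℝ)) (hP : P = {h : C(K, ℝ) | h ∈ F ∧ 0 ≤ h ∧ h ≤ 1})
    (n : ℕ) (e f : Fin n → C(K, ℝ))
    (he : ∀ i, e i ∈ P) (hf : ∀ i, f i ∈ P) (hef : ∀ i, e i ≤ f i)
    (hcover : P = ⋃ i, {h ∈ P | e i ≤ h ∧ h ≤ f i}) :
    ∃ i, {h ∈ P | e i ≤ h ∧ h ≤ f i} = P := by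
  by_contra! hproper
  let U : Fin n → Set K := fun i => {x | 0 < e i x} ∪ {x | f i x < 1}
  have hUo : ∀ i, IsOpen (U i) := fun i =>
    (isOpen_lt continuous_const (e i).continuous).union
      (isOpen_lt (f i).continuous continuous_const)
  have hUne : ∀ i, (U i).Nonempty := by
    intro i
    by_contra hne
    refine hproper i (Set.sep_eq_self_iff_mem_true.2 fun h hh => ?_)
    rw [hP] at hh
    have hout : ∀ x, ¬ (0 < e i x ∨ f i x < 1) := fun x hx => hne ⟨x, hx⟩
    exact ⟨fun x => (not_lt.1 fun hx => hout x (.inl hx)).trans (hh.2.1 x),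
      fun x => (hh.2.2 x).trans (not_lt.1 fun hx => hout x (.inr hx))⟩
  have hUinf : ∀ i, (U i).Infinite := by
    intro i
    obtain ⟨x, hx⟩ := hUne i
    have : (nhdsWithin x {x}ᶜ).NeBot :=
      ⟨fun hbot => hK x ((isOpen_singleton_iff_punctured_nhds x).2 hbot)⟩
    exact infinite_of_mem_nhds x ((hUo i).mem_nhds hx)
  obtain ⟨x, hxinj, hxU⟩ := exists_injective_mem_of_forall_infinite U hUinf
  have hsmall : ∀ c : ℝ, ∀ᶠ δ in nhdsWithin (0 : ℝ) (Set.Ioi 0), 0 < c → 2 * δ < c := by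
    intro c
    by_cases hc : 0 < c
    · filter_upwards [Ioo_mem_nhdsGT (half_pos hc)] with δ hδ _
      linarith [hδ.2]
    · exact .of_forall fun _ h => absurd h hc
  obtain ⟨δ, hδ, hδ0 : 0 < δ⟩ := ((Filter.eventually_all.2 fun i =>
    (hsmall (e i (x i))).and (hsmall (1 - f i (x i)))).and self_mem_nhdsWithin).exists
  let S : Set (Fin n) := {i | 0 < e i (x i)}
  obtain ⟨h, hhF, hh0, hh1, hhA, hhB⟩ := exists_mem_unitInterval_le_and_ge_of_dense F hsup hdense
    (S.toFinite.image x).isClosed (Sᶜ.toFinite.image x).isClosed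
    ((Set.disjoint_image_iff hxinj).2 disjoint_compl_right) hδ0
  have hhP : h ∈ P := hP ▸ ⟨hhF, hh0, hh1⟩
  rw [hcover] at hhP
  obtain ⟨i, -, hei, hfi⟩ := Set.mem_iUnion.1 hhP
  have hei : e i (x i) ≤ h (x i) := hei (x i)
  have hfi : h (x i) ≤ f i (x i) := hfi (x i)
  by_cases hi : i ∈ S
  · linarith [hhA _ (Set.mem_image_of_mem x hi), (hδ i).1 hi]
  · have hlt : f i (x i) < 1 := (hxU i).resolve_left hi
    linarith [hhB _ (Set.mem_image_of_mem x hi), (hδ i).2 (sub_pos.2 hlt)]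
end

section
/- Let S be a Tychonoff (completely regular Hausdorff) topological space and F a linear sublattice of the space C_b(S,ℝ) of bounded continuous real functions on S, dense in the supremum norm. Then f ∈ F is an atom of F if and only if there exist r > 0 and an isolated point s ∈ S such that f is r times the characteristic function of {s}. Here f is an atom of F if f > 0 and every g ∈ F with 0 ≤ g ≤ f is a real scalar multiple of f. -/
/-- A dense subset of `C_b(S, ℝ)` contains, for any two distinct points of a Tychonoff space,
a function that is positive at the first and negative at the second. -/
theorem exists_mem_pos_neg_of_dense {S : Type*} [TopologicalSpace S] [CompletelyRegularSpace S]
    [T1Space S] {F : Set (BoundedContinuousFunction S ℝ)} (hF : Dense F) {s x : S} (hsx : s ≠ x) :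
    ∃ g ∈ F, 0 < g s ∧ g x < 0 := by
  obtain ⟨φ, hφ, hφs, hφx⟩ :=
    CompletelyRegularSpace.completely_regular s {x} isClosed_singleton (by simpa using hsx)
  have hφx' : φ x = 1 := hφx rfl
  let h : BoundedContinuousFunction S ℝ :=
    BoundedContinuousFunction.ofNormedAddCommGroup (fun y => 1 - 2 * (φ y : ℝ)) (by fun_prop) 1
      (fun y => by
        rw [Real.norm_eq_abs, abs_le]
        constructor <;> linarith [(φ y).2.1, (φ y).2.2])
  have hs : h s = 1 := by simp [h, hφs]
  have hx : h x = -1 := by simp [h, hφx']; norm_num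
  obtain ⟨g, hgF, hg⟩ := hF.exists_dist_lt h one_pos
  have h₁ := (BoundedContinuousFunction.dist_coe_le_dist (f := h) (g := g) s).trans_lt hg
  have h₂ := (BoundedContinuousFunction.dist_coe_le_dist (f := h) (g := g) x).trans_lt hg
  rw [Real.dist_eq, abs_lt] at h₁ h₂
  exact ⟨g, hgF, by linarith [h₁.2], by linarith [h₂.1]⟩

/-- Let `S` be a Tychonoff space and `F` a norm-dense linear sublattice of
`C_b(S, ℝ)`. Then `f ∈ F` is an atom of `F` iff `f` is a positive scalar multiple of the
characteristic function of an isolated point of `S`. -/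
theorem denseSublattice_atoms_eq_multiples_of_isolated_indicators
    {S : Type*} [TopologicalSpace S] [CompletelyRegularSpace S] [T2Space S]
    (F : Submodule ℝ (BoundedContinuousFunction S ℝ))
    (hsup : ∀ f g : BoundedContinuousFunction S ℝ, f ∈ F → g ∈ F → f ⊔ g ∈ F)
    (hinf : ∀ f g : BoundedContinuousFunction S ℝ, f ∈ F → g ∈ F → f ⊓ g ∈ F)
    (hdense : Dense (F : Set (BoundedContinuousFunction S ℝ)))
    (f : BoundedContinuousFunction S ℝ) (hfF : f ∈ F) :
    (0 < f ∧ ∀ g ∈ F, 0 ≤ g → g ≤ f → ∃ t : ℝ, g = t • f) ↔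
      ∃ r : ℝ, 0 < r ∧ ∃ s : S, IsOpen ({s} : Set S) ∧
        ∀ x : S, f x = Set.indicator ({s} : Set S) (fun _ => r) x := by
  constructor
  · rintro ⟨hf, hatom⟩
    have hnonneg : ∀ x, 0 ≤ f x := fun x => hf.le x
    obtain ⟨s, hs⟩ : ∃ s, f s ≠ 0 := by
      by_contra! hzero
      exact hf.ne' (BoundedContinuousFunction.ext hzero)
    have hspos : 0 < f s := (hnonneg s).lt_of_ne' hs
    have hvanish : ∀ x, x ≠ s → f x = 0 := by
      intro x hxs
      by_contra hfx
      obtain ⟨g, hgF, hgs, hgx⟩ := exists_mem_pos_neg_of_dense hdense hxs.symm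
      obtain ⟨t, ht⟩ := hatom ((g ⊔ 0) ⊓ f)
        (hinf _ _ (hsup _ _ hgF F.zero_mem) hfF) (le_inf le_sup_right hf.le) inf_le_right
      have htx : min (max (g x) 0) (f x) = t * f x := DFunLike.congr_fun ht x
      have hts : min (max (g s) 0) (f s) = t * f s := DFunLike.congr_fun ht s
      rw [max_eq_right hgx.le, min_eq_left (hnonneg x)] at htx
      have ht0 : t = 0 := (mul_eq_zero.mp htx.symm).resolve_right hfx
      rw [max_eq_left hgs.le, ht0, zero_mul] at hts
      exact (lt_min hgs hspos).ne' hts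
    refine ⟨f s, hspos, s, ?_, fun x => ?_⟩
    · have hsupp : ({s} : Set S) = {x | f x ≠ 0} := by
        ext x
        refine ⟨?_, fun hx => by_contra fun hxs => hx (hvanish x hxs)⟩
        rintro rfl
        exact hs
      rw [hsupp]
      exact isOpen_ne_fun f.continuous continuous_const
    · by_cases hx : x = s
      · simp [hx]
      · simp [hx, hvanish x hx]
  · rintro ⟨r, hr, s, -, hf⟩
    have hfs : f s = r := by simp [hf s]
    have hvanish : ∀ x, x ≠ s → f x = 0 := fun x hx => by simp [hf x, hx]
    refine ⟨lt_of_le_of_ne (fun x => ?_) ?_, fun g _ hg hgf => ⟨g s / r, ?_⟩⟩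
    · change 0 ≤ f x
      rw [hf x]
      exact Set.indicator_nonneg (fun _ _ => hr.le) x
    · rintro rfl
      exact hr.ne hfs
    · ext x
      change g x = g s / r * f x
      by_cases hx : x = s
      · rw [hx, hfs, div_mul_cancel₀ _ hr.ne']
      · rw [hvanish x hx, mul_zero]
        exact le_antisymm ((hgf x).trans_eq (hvanish x hx)) (hg x)
end

section
/- Let S be a Tychonoff (completely regular Hausdorff) topological space and F a linear sublattice of the space C_b(S,ℝ) of bounded continuous real functions on S, dense in the supremum norm. Then F is atomic (for every f ∈ F with f > 0 there exists an atom a of F with a ≤ f) if and only if the set of isolated points of S is dense in S. -/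
/-- A norm-dense subspace of `C_b(S, ℝ)` closed under suprema contains, for every open
neighbourhood `U` of `s`, a nonnegative function that is positive at `s` and vanishes off `U`. -/
theorem exists_nonneg_mem_pos_of_dense
    {S : Type*} [TopologicalSpace S] [CompletelyRegularSpace S]
    {F : Submodule ℝ (BoundedContinuousFunction S ℝ)}
    (hsup : ∀ f g : BoundedContinuousFunction S ℝ, f ∈ F → g ∈ F → f ⊔ g ∈ F)
    (hdense : Dense (F : Set (BoundedContinuousFunction S ℝ)))
    {U : Set S} (hU : IsOpen U) {s : S} (hs : s ∈ U) :
    ∃ f ∈ F, 0 ≤ f ∧ 0 < f s ∧ ∀ x ∉ U, f x = 0 := by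
  obtain ⟨φ, hφ, hφs, hφU⟩ :=
    CompletelyRegularSpace.completely_regular s Uᶜ hU.isClosed_compl (by simpa using hs)
  let w : BoundedContinuousFunction S ℝ :=
    BoundedContinuousFunction.ofNormedAddCommGroup (fun x => 1 - 2 * (φ x : ℝ)) (by fun_prop) 1
      fun x => by
        rw [Real.norm_eq_abs, abs_le]
        constructor <;> linarith [(φ x).2.1, (φ x).2.2]
  have hw : ∀ x, w x = 1 - 2 * (φ x : ℝ) := fun _ => rfl
  obtain ⟨v, hvF, hv⟩ := hdense.exists_dist_lt w one_pos
  have hvw : ∀ x, |w x - v x| < 1 := fun x =>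
    (BoundedContinuousFunction.dist_coe_le_dist x).trans_lt hv
  refine ⟨v ⊔ 0, hsup v 0 hvF F.zero_mem, le_sup_right, ?_, fun x hx => ?_⟩
  · have h := (abs_lt.1 (hvw s)).2
    rw [hw, hφs] at h
    norm_num at h
    simpa using h
  · have h := (abs_lt.1 (hvw x)).1
    rw [hw, hφU hx] at h
    norm_num at h
    have h' : v x ≤ 0 := by linarith
    simpa using h'

/-- A positive bounded continuous function is positive at some point. -/
theorem BoundedContinuousFunction.exists_apply_pos_of_pos
    {S : Type*} [TopologicalSpace S] {f : BoundedContinuousFunction S ℝ} (hf : 0 < f) :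
    ∃ x, 0 < f x := by
  by_contra! h
  exact hf.not_ge h

/-- A nonnegative bounded continuous function that is positive at some point is positive. -/
theorem BoundedContinuousFunction.pos_of_nonneg_of_apply_pos
    {S : Type*} [TopologicalSpace S] {f : BoundedContinuousFunction S ℝ} (hf : 0 ≤ f) {x : S}
    (hx : 0 < f x) : 0 < f :=
  lt_of_le_not_ge hf fun h => (h x).not_gt hx


/-- Let `S` be a Tychonoff space and `F` a norm-dense linear sublattice of
`C_b(S, ℝ)`. Then `F` is atomic iff the set of isolated points of `S` is dense in `S`. -/
theorem denseSublattice_atomic_iff_denseIsolatedPoints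
    {S : Type*} [TopologicalSpace S] [CompletelyRegularSpace S] [T2Space S]
    (F : Submodule ℝ (BoundedContinuousFunction S ℝ))
    (hsup : ∀ f g : BoundedContinuousFunction S ℝ, f ∈ F → g ∈ F → f ⊔ g ∈ F)
    (hinf : ∀ f g : BoundedContinuousFunction S ℝ, f ∈ F → g ∈ F → f ⊓ g ∈ F)
    (hdense : Dense (F : Set (BoundedContinuousFunction S ℝ))) :
    (∀ f ∈ F, 0 < f → ∃ a ∈ F,
        (0 < a ∧ ∀ g ∈ F, 0 ≤ g → g ≤ a → ∃ t : ℝ, g = t • a) ∧ a ≤ f) ↔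
      Dense {s : S | IsOpen ({s} : Set S)} := by
  constructor
  · intro hatom
    refine dense_iff_inter_open.2 fun U hU ⟨s, hs⟩ => ?_
    obtain ⟨f, hfF, hf0, hfs, hfU⟩ := exists_nonneg_mem_pos_of_dense hsup hdense hU hs
    obtain ⟨a, haF, ⟨ha0, ha⟩, haf⟩ :=
      hatom f hfF (BoundedContinuousFunction.pos_of_nonneg_of_apply_pos hf0 hfs)
    obtain ⟨x, hx⟩ := BoundedContinuousFunction.exists_apply_pos_of_pos ha0
    have hxU : x ∈ U := by
      by_contra h
      exact (haf x).not_gt ((hfU x h).trans_lt hx)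
    have hsupp : {y | 0 < a y} = {x} := by
      refine Set.eq_singleton_iff_unique_mem.2 ⟨hx, fun y hy => ?_⟩
      by_contra hyx
      obtain ⟨g, hgF, hg0, hgx, hgy⟩ := exists_nonneg_mem_pos_of_dense hsup hdense
        (isOpen_compl_singleton (x := y)) (s := x) (Ne.symm hyx)
      obtain ⟨t, ht⟩ := ha (g ⊓ a) (hinf g a hgF haF) (le_inf hg0 ha0.le) inf_le_right
      have hty : min (g y) (a y) = t * a y := DFunLike.congr_fun ht y
      have htx : min (g x) (a x) = t * a x := DFunLike.congr_fun ht x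
      have hy' : 0 < a y := hy
      rw [hgy y (by simp), min_eq_left hy'.le] at hty
      have ht0 : t = 0 := (mul_eq_zero.1 hty.symm).resolve_right hy'.ne'
      rw [ht0, zero_mul] at htx
      exact (lt_min hgx hx).ne' htx
    refine ⟨x, hxU, ?_⟩
    rw [Set.mem_ofPred_eq, ← hsupp]
    exact isOpen_lt continuous_const a.continuous
  · intro hd f hfF hf
    obtain ⟨s, hfs, hs⟩ := dense_iff_inter_open.1 hd {x | 0 < f x}
      (isOpen_lt continuous_const f.continuous)
      (BoundedContinuousFunction.exists_apply_pos_of_pos hf)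
    obtain ⟨g, hgF, hg0, hgs, hg⟩ :=
      exists_nonneg_mem_pos_of_dense hsup hdense hs (Set.mem_singleton s)
    have has : 0 < (g ⊓ f) s := lt_min hgs hfs
    refine ⟨g ⊓ f, hinf g f hgF hfF, ⟨BoundedContinuousFunction.pos_of_nonneg_of_apply_pos
      (le_inf hg0 hf.le) has, fun h _ hh0 hh => ⟨h s / (g ⊓ f) s, ?_⟩⟩, inf_le_right⟩
    ext x
    change h x = h s / (g ⊓ f) s * (g ⊓ f) x
    by_cases hxs : x = s
    · rw [hxs, div_mul_cancel₀ _ has.ne']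
    · have hgx : g x = 0 := hg x hxs
      have hax : (g ⊓ f) x = 0 := (min_eq_left (hgx.trans_le (hf.le x))).trans hgx
      rw [hax, mul_zero]
      exact le_antisymm ((hh x).trans_eq hax) (hh0 x)
end

section
/- Let K be a compact Hausdorff extremally disconnected topological space (the closure of every open set is open) whose set U of isolated points is dense in K. Then K is homeomorphic to the Stone–Čech compactification of U endowed with the discrete topology. -/
universe u

/-- The extension of an injective map with dense range to the Stone–Čech compactification of its
domain has singleton fibres over isolated points in the image of the map. -/
theorem eq_stoneCechUnit_of_stoneCechExtend_eq {X K : Type*} [TopologicalSpace X]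
    [TopologicalSpace K] [CompactSpace K] [T2Space K] {j : X → K} (hj : Continuous j)
    (hinj : Function.Injective j) {x : X} (hx : IsOpen ({j x} : Set K)) {p : StoneCech X}
    (hp : stoneCechExtend hj p = j x) : p = stoneCechUnit x := by
  have hopen : IsOpen (stoneCechExtend hj ⁻¹' {j x}) :=
    hx.preimage (continuous_stoneCechExtend hj)
  have hsub : stoneCechExtend hj ⁻¹' {j x} ∩ Set.range stoneCechUnit ⊆ {stoneCechUnit x} := by
    rintro _ ⟨hq, y, rfl⟩
    rw [Set.mem_preimage, stoneCechExtend_stoneCechUnit, Set.mem_singleton_iff] at hq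
    rw [hinj hq, Set.mem_singleton_iff]
  have hmem := closure_mono hsub (denseRange_stoneCechUnit.open_subset_closure_inter hopen hp)
  rwa [closure_singleton] at hmem

/-- A compact Hausdorff extremally disconnected space is homeomorphic to the Stone–Čech
compactification of any space mapping injectively onto a dense set of isolated points. -/
theorem nonempty_homeomorph_stoneCech_of_denseRange {X K : Type u} [TopologicalSpace X]
    [TopologicalSpace K] [CompactSpace K] [T2Space K] [ExtremallyDisconnected K] {j : X → K}
    (hj : Continuous j) (hinj : Function.Injective j) (hdense : DenseRange j)
    (hisol : ∀ x, IsOpen ({j x} : Set K)) : Nonempty (K ≃ₜ StoneCech X) := by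
  have hf := continuous_stoneCechExtend hj
  have hsurj : Function.Surjective (stoneCechExtend hj) := by
    rw [← Set.range_eq_univ, ← (isCompact_range hf).isClosed.closure_eq]
    refine Dense.closure_eq (hdense.mono ?_)
    rintro _ ⟨x, rfl⟩
    exact ⟨stoneCechUnit x, stoneCechExtend_stoneCechUnit hj x⟩
  obtain ⟨h, hh, hsec⟩ :=
    CompactT2.ExtremallyDisconnected.projective (A := K) continuous_id hf hsurj
  have hret : h ∘ stoneCechExtend hj = id := by
    refine stoneCech_hom_ext (hh.comp hf) continuous_id (funext fun x => ?_)
    apply eq_stoneCechUnit_of_stoneCechExtend_eq hj hinj (hisol x)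
    simpa [stoneCechExtend_stoneCechUnit] using congrFun hsec (j x)
  exact ⟨{ toFun := h
           invFun := stoneCechExtend hj
           left_inv := congrFun hsec
           right_inv := congrFun hret
           continuous_toFun := hh
           continuous_invFun := hf }⟩

/-- A compact Hausdorff extremally disconnected space with a dense set of
isolated points is homeomorphic to the Stone–Čech compactification of its set of isolated
points with the discrete topology. -/
theorem extremallyDisconnected_denseIsolated_homeomorph_stoneCech
    {K : Type*} [TopologicalSpace K] [CompactSpace K] [T2Space K]
    [ExtremallyDisconnected K]
    (hdense : Dense {x : K | IsOpen ({x} : Set K)}) :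
    Nonempty (K ≃ₜ @StoneCech {x : K // IsOpen ({x} : Set K)} ⊥) :=
  @nonempty_homeomorph_stoneCech_of_denseRange _ K ⊥ _ _ _ _ Subtype.val continuous_bot
    Subtype.val_injective hdense.denseRange_val Subtype.property
end
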